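/- Let d ≥ 2, let M be the uncentered maximal operator on ℝ^d associated to balls of the euclidean (ℓ₂) norm, and let ω be a modulus of continuity (distances measured in the ℓ₂ norm). Then ‖M‖_{Op(ω)} = sup_{t>0} inf_{1/2 ≤ R ≤ 1} [ (d−1)Γ(1 + d/2) / (ω(t) √π Γ(1/2 + d/2)) ] · ∫_{−1}^{1} ∫_{0}^{√(1−u₁²)} ω( t·√((1 − R + R u₁)² + R² ρ²) ) ρ^{d−2} dρ du₁. -/

import Mathlib

open MeasureTheory Set Filter Topology

/-- The closed ball of the norm-like function `N`, with center `c` and radius `R`. -/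
def nball {d : ℕ} (N : (Fin d → ℝ) → ℝ) (c : Fin d → ℝ) (R : ℝ) : Set (Fin d → ℝ) :=
  {y | N (y - c) ≤ R}

/-- The uncentered Hardy–Littlewood maximal function associated to the norm `N`,
with respect to `d`-dimensional Lebesgue measure. -/
noncomputable def maxFn {d : ℕ} (N : (Fin d → ℝ) → ℝ) (f : (Fin d → ℝ) → ℝ)
    (x : Fin d → ℝ) : ℝ :=
  sSup {a : ℝ | ∃ c : Fin d → ℝ, ∃ R : ℝ, 0 < R ∧ x ∈ nball N c R ∧
    a = ⨍ y in nball N c R, |f y|}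

/-- The modulus of continuity of `g`, with distances measured using `N`. -/
noncomputable def modCont {d : ℕ} (N : (Fin d → ℝ) → ℝ) (g : (Fin d → ℝ) → ℝ) (δ : ℝ) : ℝ :=
  sSup {a : ℝ | ∃ x y : Fin d → ℝ, N (x - y) ≤ δ ∧ a = |g x - g y|}

/-- `N` is a norm on `ℝ^d`. -/
structure IsNorm {d : ℕ} (N : (Fin d → ℝ) → ℝ) : Prop where
  eq_zero_iff : ∀ x, N x = 0 ↔ x = 0
  add_le : ∀ x y, N (x + y) ≤ N x + N y
  smul : ∀ (a : ℝ) (x), N (a • x) = |a| * N x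

/-- `ω` is a modulus of continuity: continuous, nondecreasing, subadditive on `[0,∞)`,
vanishing at `0`, nonnegative, and not identically zero. -/
structure IsModulus (ω : ℝ → ℝ) : Prop where
  nonneg : ∀ t, 0 ≤ t → 0 ≤ ω t
  map_zero : ω 0 = 0
  mono : MonotoneOn ω (Ici 0)
  subadd : ∀ a b, 0 ≤ a → 0 ≤ b → ω (a + b) ≤ ω a + ω b
  cont : ContinuousOn ω (Ici 0)
  nontrivial : ∃ t, 0 < t ∧ ω t ≠ 0

/-- The `Lip(ω)` seminorm of `f`: `sup_{t>0} ω(f,t)/ω(t)`. -/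
noncomputable def lipNorm {d : ℕ} (N : (Fin d → ℝ) → ℝ) (ω : ℝ → ℝ)
    (f : (Fin d → ℝ) → ℝ) : ℝ :=
  sSup {a : ℝ | ∃ t : ℝ, 0 < t ∧ a = modCont N f t / ω t}

/-- The operator norm of the uncentered maximal operator on `Lip(ω)`. -/
noncomputable def opNorm (d : ℕ) (N : (Fin d → ℝ) → ℝ) (ω : ℝ → ℝ) : ℝ :=
  sSup {a : ℝ | ∃ f : (Fin d → ℝ) → ℝ, lipNorm N ω f = 1 ∧ a = lipNorm N ω (maxFn N f)}

/-- The Hölder `α` seminorm of `f`, distances measured with `N`. -/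
noncomputable def holderNorm {d : ℕ} (N : (Fin d → ℝ) → ℝ) (α : ℝ)
    (f : (Fin d → ℝ) → ℝ) : ℝ :=
  sSup {a : ℝ | ∃ x y : Fin d → ℝ, x ≠ y ∧ a = |f x - f y| / N (x - y) ^ α}

/-- The operator norm of the uncentered maximal operator on the Hölder class `Lip_α`. -/
noncomputable def opNormHolder (d : ℕ) (N : (Fin d → ℝ) → ℝ) (α : ℝ) : ℝ :=
  sSup {a : ℝ | ∃ f : (Fin d → ℝ) → ℝ, holderNorm N α f = 1 ∧
    a = holderNorm N α (maxFn N f)}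

section MaximalFunction

open Metric
open scoped Pointwise

variable {E : Type*} [NormedAddCommGroup E] [InnerProductSpace ℝ E]

/-- The reflection of `z` in the bisector of `c` and `c'` is at least as close to the origin
as `z`, provided that `z` lies on the side of `c` and the origin on the side of `c'`. -/
theorem norm_sq_bisector_reflection (c c' z : E) :
    ‖c - c'‖ ^ 2 * (‖z‖ ^ 2 - ‖c' + (ℝ ∙ (c - c'))ᗮ.reflection (z - c)‖ ^ 2) =
      (‖z - c'‖ ^ 2 - ‖z - c‖ ^ 2) * (‖c‖ ^ 2 - ‖c'‖ ^ 2) := by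
  obtain ⟨n, rfl⟩ : ∃ n, c' = c - n := ⟨c - c', by abel⟩
  rw [sub_sub_cancel]
  rcases eq_or_ne n 0 with rfl | hne
  · simp
  have hn : ‖n‖ ^ 2 ≠ 0 := pow_ne_zero 2 (norm_ne_zero_iff.2 hne)
  set α := inner ℝ n (z - c) / ‖n‖ ^ 2 with hα
  have h1 : c - n + (ℝ ∙ n)ᗮ.reflection (z - c) = z - (1 + 2 * α) • n := by
    rw [Submodule.reflection_orthogonal_apply, Submodule.reflection_singleton_apply]
    simp only [RCLike.ofReal_real_eq_id, id, ← hα]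
    rw [← Nat.cast_smul_eq_nsmul ℝ]
    module
  have hz : inner ℝ n z = α * ‖n‖ ^ 2 + inner ℝ n c := by
    rw [hα, div_mul_cancel₀ _ hn, inner_sub_right]
    ring
  have h2 : ‖z - (c - n)‖ ^ 2 = ‖z - c‖ ^ 2 + 2 * (inner ℝ n z - inner ℝ n c) + ‖n‖ ^ 2 := by
    rw [show z - (c - n) = (z - c) + n by abel, norm_add_sq_real, inner_sub_left,
      real_inner_comm n z, real_inner_comm n c]
  rw [h1, h2, norm_sub_sq_real z, norm_sub_sq_real c n, norm_smul, inner_smul_right, mul_pow,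
    Real.norm_eq_abs, sq_abs, real_inner_comm n z, real_inner_comm n c, hz]
  ring

theorem mul_norm_shift {t R : ℝ} (ht : 0 ≤ t) (e u : E) :
    t * ‖(1 - R) • e + R • u‖ = ‖(t * (1 - R)) • e + (t * R) • u‖ := by
  rw [mul_smul, mul_smul, ← smul_add, norm_smul, Real.norm_of_nonneg ht]

theorem norm_shift_le_one {R : ℝ} (h0 : 0 ≤ R) (h1 : R ≤ 1) {e u : E} (he : ‖e‖ = 1)
    (hu : ‖u‖ ≤ 1) : ‖(1 - R) • e + R • u‖ ≤ 1 := by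
  refine (norm_add_le _ _).trans ?_
  rw [norm_smul, norm_smul, he, Real.norm_of_nonneg h0, Real.norm_of_nonneg (sub_nonneg.2 h1)]
  nlinarith

theorem continuous_comp_shift {ω : ℝ → ℝ} (hω : ContinuousOn ω (Ici 0)) {t : ℝ} (ht : 0 ≤ t)
    (R : ℝ) (e : E) : Continuous fun u : E => ω (t * ‖(1 - R) • e + R • u‖) :=
  hω.comp_continuous (by fun_prop) fun u => mul_nonneg ht (norm_nonneg _)

variable [FiniteDimensional ℝ E] [MeasurableSpace E] [BorelSpace E]

/-- Averages over a ball of positive radius are averages over the unit ball. -/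
theorem setAverage_closedBall_eq (g : E → ℝ) (c : E) {r : ℝ} (hr : 0 < r) :
    ⨍ z in closedBall c r, g z = ⨍ u in closedBall (0 : E) 1, g (c + r • u) := by
  have himg : r • closedBall (0 : E) 1 = closedBall 0 r := by
    rw [smul_unitClosedBall, Real.norm_of_nonneg hr.le]
  have h1 := Measure.setIntegral_comp_smul_of_pos (volume : Measure E) (fun z => g (c + z))
    (closedBall (0 : E) 1) hr
  rw [himg] at h1
  have h2 : ∫ z in closedBall (0 : E) r, g (c + z) = ∫ z in closedBall c r, g z := by
    rw [← integral_indicator measurableSet_closedBall,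
      ← integral_indicator measurableSet_closedBall,
      ← integral_add_left_eq_self (fun z => (closedBall c r).indicator g z) c]
    congr 1
    ext z
    simp [indicator, mem_closedBall, dist_eq_norm]
  have h3 : volume.real (closedBall c r) =
      r ^ Module.finrank ℝ E * volume.real (closedBall (0 : E) 1) := by
    simp only [Measure.real]
    rw [Measure.addHaar_closedBall' _ _ hr.le, ENNReal.toReal_mul,
      ENNReal.toReal_ofReal (by positivity)]
  rw [setAverage_eq, setAverage_eq, h1, h2, h3]
  simp only [smul_eq_mul, mul_inv]
  ring

theorem volume_real_closedBall_pos : 0 < volume.real (closedBall (0 : E) 1) :=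
  ENNReal.toReal_pos (measure_closedBall_pos _ _ one_pos).ne' measure_closedBall_lt_top.ne

theorem setAverage_unitBall_mono {g h : E → ℝ} (hg : Continuous g) (hh : Continuous h)
    (hgh : ∀ u : E, ‖u‖ ≤ 1 → g u ≤ h u) :
    ⨍ u in closedBall (0 : E) 1, g u ≤ ⨍ u in closedBall (0 : E) 1, h u := by
  rw [setAverage_eq, setAverage_eq]
  refine smul_le_smul_of_nonneg_left ?_ (by positivity)
  refine setIntegral_mono_on (hg.continuousOn.integrableOn_compact (isCompact_closedBall _ _))
    (hh.continuousOn.integrableOn_compact (isCompact_closedBall _ _)) measurableSet_closedBall ?_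
  intro u hu
  exact hgh u (by simpa using hu)

theorem setAverage_unitBall_const (a : ℝ) : ⨍ _u in closedBall (0 : E) 1, a = a := by
  rw [setAverage_eq, setIntegral_const, smul_smul,
    inv_mul_cancel₀ volume_real_closedBall_pos.ne', one_smul]

theorem setAverage_unitBall_add {g h : E → ℝ} (hg : Continuous g) (hh : Continuous h) :
    ⨍ u in closedBall (0 : E) 1, (g u + h u) =
      (⨍ u in closedBall (0 : E) 1, g u) + ⨍ u in closedBall (0 : E) 1, h u := by
  simp only [setAverage_eq]
  rw [integral_add (hg.continuousOn.integrableOn_compact (isCompact_closedBall _ _))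
    (hh.continuousOn.integrableOn_compact (isCompact_closedBall _ _)), smul_add]

/-- Among balls of a fixed radius, the average of a radially nondecreasing function is
nondecreasing in the distance of the center to the origin. -/
theorem setAverage_radial_mono {ψ : ℝ → ℝ} (hψ : MonotoneOn ψ (Ici 0))
    (hcont : ContinuousOn ψ (Ici 0)) {c c' : E} (hc : ‖c'‖ ≤ ‖c‖) {r : ℝ} (hr : 0 < r) :
    ⨍ u in closedBall (0 : E) 1, ψ ‖c' + r • u‖ ≤ ⨍ u in closedBall (0 : E) 1, ψ ‖c + r • u‖ := by
  rcases eq_or_ne c c' with rfl | hne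
  · exact le_rfl
  rw [← setAverage_closedBall_eq (fun z => ψ ‖z‖) c' hr,
    ← setAverage_closedBall_eq (fun z => ψ ‖z‖) c hr, setAverage_eq, setAverage_eq]
  have hvol : volume.real (closedBall c' r) = volume.real (closedBall c r) := by
    simp only [Measure.real]
    rw [Measure.addHaar_closedBall_center, Measure.addHaar_closedBall_center volume c]
  rw [hvol]
  refine smul_le_smul_of_nonneg_left ?_ (by positivity)
  have hg : Continuous fun z : E => ψ ‖z‖ :=
    hcont.comp_continuous continuous_norm fun z => norm_nonneg z
  have hH_int : ∀ a : E, Integrable ((closedBall a r).indicator fun z => ψ ‖z‖) := fun a =>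
    (integrable_indicator_iff measurableSet_closedBall).2
      (hg.continuousOn.integrableOn_compact (isCompact_closedBall _ _))
  rw [← integral_indicator measurableSet_closedBall,
    ← integral_indicator measurableSet_closedBall, ← sub_nonneg,
    ← integral_sub (hH_int c) (hH_int c')]
  set h : E → ℝ := fun z => (closedBall c r).indicator (fun z => ψ ‖z‖) z -
    (closedBall c' r).indicator (fun z => ψ ‖z‖) z with hh
  have h_int : Integrable h := (hH_int c).sub (hH_int c')
  let ρ := (ℝ ∙ (c - c'))ᗮ.reflection
  have hemb : MeasurableEmbedding ρ := ρ.toHomeomorph.measurableEmbedding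
  have hI : ∫ z, h (c' + ρ (z - c)) = ∫ z, h z := by
    rw [integral_sub_right_eq_self (fun z => h (c' + ρ z)) c,
      ρ.measurePreserving.integral_comp hemb (fun z => h (c' + z)),
      integral_add_left_eq_self h c']
  have hi : Integrable fun z => h (c' + ρ (z - c)) := by
    have h1 : Integrable fun z => h (c' + z) := h_int.comp_add_left c'
    have h2 : Integrable fun z => h (c' + ρ z) :=
      ρ.measurePreserving.integrable_comp_of_integrable h1
    exact h2.comp_sub_right c
  have hsum : 0 ≤ ∫ z, (h z + h (c' + ρ (z - c))) := by
    refine integral_nonneg fun z => ?_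
    have key := norm_sq_bisector_reflection c c' z
    have hn : 0 < ‖c - c'‖ ^ 2 := pow_pos (norm_pos_iff.2 (sub_ne_zero.2 hne)) 2
    have e1 : ‖c' + ρ (z - c) - c'‖ = ‖z - c‖ := by
      rw [add_sub_cancel_left, LinearIsometryEquiv.norm_map]
    have e2 : ‖c' + ρ (z - c) - c‖ = ‖z - c'‖ := by
      have : c' + ρ (z - c) - c = ρ (z - c') := by
        have h3 : ρ (c - c') = -(c - c') :=
          Submodule.reflection_orthogonalComplement_singleton_eq_neg (c - c')
        have : z - c' = (z - c) + (c - c') := by abel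
        rw [this, map_add, h3]
        abel
      rw [this, LinearIsometryEquiv.norm_map]
    have hcc : 0 ≤ ‖c‖ ^ 2 - ‖c'‖ ^ 2 := by
      have := norm_nonneg c'
      nlinarith
    simp only [hh, indicator, mem_closedBall, dist_eq_norm, e1, e2, Pi.zero_apply]
    change ‖c - c'‖ ^ 2 * (‖z‖ ^ 2 - ‖c' + ρ (z - c)‖ ^ 2) = _ at key
    have n1 := norm_nonneg (z - c)
    have n2 := norm_nonneg (z - c')
    have n3 := norm_nonneg z
    have n4 := norm_nonneg (c' + ρ (z - c))
    split_ifs with k1 k2 k2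
    · simp
    · have : 0 ≤ (‖z - c'‖ ^ 2 - ‖z - c‖ ^ 2) * (‖c‖ ^ 2 - ‖c'‖ ^ 2) :=
        mul_nonneg (by nlinarith) hcc
      rw [← key] at this
      have hle : ‖c' + ρ (z - c)‖ ≤ ‖z‖ :=
        abs_le_of_sq_le_sq' (by linarith [nonneg_of_mul_nonneg_right this hn]) n3 |>.2
      simpa using hψ n4 n3 hle
    · have : (‖z - c'‖ ^ 2 - ‖z - c‖ ^ 2) * (‖c‖ ^ 2 - ‖c'‖ ^ 2) ≤ 0 :=
        mul_nonpos_of_nonpos_of_nonneg (by nlinarith) hcc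
      rw [← key] at this
      have hle : ‖z‖ ≤ ‖c' + ρ (z - c)‖ :=
        abs_le_of_sq_le_sq' (by linarith [nonpos_of_mul_nonpos_right this hn]) n4 |>.2
      simpa using hψ n3 n4 hle
    · simp
  rw [integral_add h_int hi, hI] at hsum
  change 0 ≤ ∫ z, h z
  linarith

/-- The average of `ω` of the distance to the origin over the ball of radius `t * R` with center
`t * (1 - R) • e`. -/
noncomputable def shiftedAvg (ω : ℝ → ℝ) (t R : ℝ) (e : E) : ℝ :=
  ⨍ u in closedBall (0 : E) 1, ω (t * ‖(1 - R) • e + R • u‖)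

theorem shiftedAvg_eq {ω : ℝ → ℝ} {t R : ℝ} (ht : 0 ≤ t) (e : E) :
    shiftedAvg ω t R e = ⨍ u in closedBall (0 : E) 1, ω ‖(t * (1 - R)) • e + (t * R) • u‖ := by
  simp only [shiftedAvg, mul_norm_shift ht]

theorem shiftedAvg_unit_eq {ω : ℝ → ℝ} (hω : IsModulus ω) {t R : ℝ} (ht : 0 < t) (hR : 0 < R)
    {e e' : E} (he : ‖e‖ = ‖e'‖) : shiftedAvg ω t R e = shiftedAvg ω t R e' := by
  have h : ‖(t * (1 - R)) • e‖ = ‖(t * (1 - R)) • e'‖ := by rw [norm_smul, norm_smul, he]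
  rw [shiftedAvg_eq ht.le, shiftedAvg_eq ht.le]
  exact le_antisymm (setAverage_radial_mono hω.mono hω.cont h.le (mul_pos ht hR))
    (setAverage_radial_mono hω.mono hω.cont h.ge (mul_pos ht hR))

theorem shiftedAvg_mono {ω : ℝ → ℝ} (hω : IsModulus ω) {s t : ℝ} (hs : 0 ≤ s) (hst : s ≤ t)
    (R : ℝ) (e : E) : shiftedAvg ω s R e ≤ shiftedAvg ω t R e := by
  refine setAverage_unitBall_mono (continuous_comp_shift hω.cont hs R e)
    (continuous_comp_shift hω.cont (hs.trans hst) R e) fun u _ => ?_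
  exact hω.mono (mul_nonneg hs (norm_nonneg _)) (mul_nonneg (hs.trans hst) (norm_nonneg _))
    (by gcongr)

theorem shiftedAvg_nonneg {ω : ℝ → ℝ} (hω : IsModulus ω) {t : ℝ} (ht : 0 ≤ t) (R : ℝ) (e : E) :
    0 ≤ shiftedAvg ω t R e := by
  rw [← setAverage_unitBall_const (E := E) 0]
  exact setAverage_unitBall_mono continuous_const (continuous_comp_shift hω.cont ht R e)
    fun u _ => hω.nonneg _ (mul_nonneg ht (norm_nonneg _))

theorem shiftedAvg_le {ω : ℝ → ℝ} (hω : IsModulus ω) {t R : ℝ} (ht : 0 ≤ t) (h0 : 0 ≤ R)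
    (h1 : R ≤ 1) {e : E} (he : ‖e‖ = 1) : shiftedAvg ω t R e ≤ ω t := by
  rw [← setAverage_unitBall_const (E := E) (ω t)]
  exact setAverage_unitBall_mono (continuous_comp_shift hω.cont ht R e) continuous_const
    fun u hu => hω.mono (mul_nonneg ht (norm_nonneg _)) ht
      (mul_le_of_le_one_right ht (norm_shift_le_one h0 h1 he hu))

/-- Among all balls containing `t • e`, the average of a radially nondecreasing function is
smallest for a ball centered on the segment from `0` to `t • e` with `t • e` on its boundary. -/
theorem exists_shifted_setAverage_le {ψ : ℝ → ℝ} (hψ : MonotoneOn ψ (Ici 0))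
    (hcont : ContinuousOn ψ (Ici 0)) {t r : ℝ} (ht : 0 < t) (hr : 0 < r) {c e : E}
    (he : ‖e‖ = 1) (hc : ‖t • e - c‖ ≤ r) :
    ∃ R : ℝ, 1 / 2 ≤ R ∧ R ≤ 1 ∧ shiftedAvg ψ t R e ≤
      ⨍ u in closedBall (0 : E) 1, ψ ‖c + r • u‖ := by
  have hcont' : ∀ (a : E) (s : ℝ), Continuous fun u : E => ψ ‖a + s • u‖ := fun a s =>
    hcont.comp_continuous (by fun_prop) fun u => norm_nonneg _
  have hct : t - r ≤ ‖c‖ := by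
    have := norm_sub_norm_le (t • e) c
    rw [norm_smul, he, Real.norm_of_nonneg ht.le] at this
    linarith
  rcases le_total t r with htr | hrt
  · refine ⟨1, by norm_num, le_rfl, ?_⟩
    rw [shiftedAvg_eq ht.le]
    calc _ ≤ ⨍ u in closedBall (0 : E) 1, ψ ‖(0 : E) + r • u‖ := by
          refine setAverage_unitBall_mono (hcont' _ _) (hcont' _ _) fun u _ => ?_
          refine hψ (norm_nonneg _) (norm_nonneg _) ?_
          simp only [sub_self, mul_zero, zero_smul, zero_add, mul_one, norm_smul,
            Real.norm_of_nonneg ht.le, Real.norm_of_nonneg hr.le]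
          gcongr
      _ ≤ _ := setAverage_radial_mono hψ hcont (by simp) hr
  have hshift : ⨍ u in closedBall (0 : E) 1, ψ ‖(t - r) • e + r • u‖ ≤
      ⨍ u in closedBall (0 : E) 1, ψ ‖c + r • u‖ := by
    refine setAverage_radial_mono hψ hcont ?_ hr
    rwa [norm_smul, he, mul_one, Real.norm_of_nonneg (sub_nonneg.2 hrt)]
  rcases le_total (t / 2) r with h2 | h2
  · refine ⟨r / t, ?_, (div_le_one ht).2 hrt, ?_⟩
    · rw [le_div_iff₀ ht]
      linarith
    · rw [shiftedAvg_eq ht.le, mul_sub, mul_div_cancel₀ _ ht.ne', mul_one]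
      exact hshift
  · refine ⟨1 / 2, le_rfl, by norm_num, le_trans ?_ hshift⟩
    rw [shiftedAvg_eq ht.le]
    refine setAverage_unitBall_mono (hcont' _ _) (hcont' _ _) fun u hu => ?_
    refine hψ (norm_nonneg _) (norm_nonneg _) ?_
    refine abs_le_of_sq_le_sq' ?_ (norm_nonneg _) |>.2
    rw [norm_add_sq_real, norm_add_sq_real]
    simp only [norm_smul, inner_smul_left, inner_smul_right, he, mul_pow, Real.norm_eq_abs,
      sq_abs, conj_trivial]
    have hin : inner ℝ e u ≤ 1 := by
      have := real_inner_le_norm e u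
      rw [he] at this
      linarith
    obtain ⟨h, rfl⟩ : ∃ h, r = t / 2 - h := ⟨t / 2 - r, by ring⟩
    have hh : 0 ≤ h := by linarith
    have hu2 : ‖u‖ ^ 2 ≤ 1 := by
      have := norm_nonneg u
      nlinarith
    have hsq : 0 ≤ 1 + ‖u‖ ^ 2 - 2 * inner ℝ e u := by
      have := sq_nonneg ‖e - u‖
      rw [norm_sub_sq_real, he] at this
      linarith
    nlinarith [mul_nonneg (mul_nonneg ht.le hh) (sub_nonneg.2 hu2), mul_nonneg (sq_nonneg h) hsq]

/-- A ball containing `x` can be moved onto a ball containing `y` so that the average of a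
function with modulus of continuity `ω` drops by at most a shifted average of `ω`. -/
theorem exists_ball_setAverage_le {ω : ℝ → ℝ} (hω : IsModulus ω) {g : E → ℝ}
    (hg : ∀ x y, |g x - g y| ≤ ω ‖x - y‖) (hgc : Continuous g) {x y c e : E} {r t R : ℝ}
    (hr : 0 < r) (hx : ‖x - c‖ ≤ r) (ht : 0 < t) (hxy : ‖x - y‖ ≤ t) (hR0 : 0 < R)
    (he : ‖e‖ = 1) :
    ∃ (c' : E) (r' : ℝ), 0 < r' ∧ ‖y - c'‖ ≤ r' ∧
      ⨍ u in closedBall (0 : E) 1, g (c + r • u) ≤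
        (⨍ u in closedBall (0 : E) 1, g (c' + r' • u)) + shiftedAvg ω t R e := by
  rcases le_or_gt ‖y - c‖ r with hy | hy
  · exact ⟨c, r, hr, hy, le_add_of_nonneg_right (shiftedAvg_nonneg hω ht.le R e)⟩
  set τ := ‖y - c‖ - r with hτ_def
  have hτ : 0 < τ := sub_pos.2 hy
  have hτt : τ ≤ t := by
    have h1 : ‖y - c‖ ≤ ‖y - x‖ + ‖x - c‖ := norm_sub_le_norm_sub_add_norm_sub y x c
    rw [norm_sub_rev y x] at h1
    linarith
  have hyc : 0 < ‖y - c‖ := hr.trans hy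
  set v := ‖y - c‖⁻¹ • (y - c) with hv_def
  have hv : ‖v‖ = 1 := by
    rw [hv_def, norm_smul, norm_inv, norm_norm, inv_mul_cancel₀ hyc.ne']
  have hyv : y - c = (r + τ) • v := by
    rw [hv_def, smul_smul, hτ_def, add_sub_cancel, mul_inv_cancel₀ hyc.ne', one_smul]
  refine ⟨c + (τ * (1 - R)) • v, r + τ * R, by positivity, ?_, ?_⟩
  · have : y - (c + (τ * (1 - R)) • v) = (r + τ * R) • v := by
      rw [← sub_sub, hyv]
      module
    rw [this, norm_smul, hv, mul_one, Real.norm_of_nonneg (by positivity)]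
  · have h1 : shiftedAvg ω τ R v ≤ shiftedAvg ω t R e := by
      rw [shiftedAvg_unit_eq hω ht hR0 (he.trans hv.symm)]
      exact shiftedAvg_mono hω hτ.le hτt R v
    refine le_trans ?_ (add_le_add_right h1 _)
    rw [shiftedAvg, ← setAverage_unitBall_add (by fun_prop)
      (continuous_comp_shift hω.cont hτ.le R v)]
    refine setAverage_unitBall_mono (by fun_prop) (Continuous.add (by fun_prop)
      (continuous_comp_shift hω.cont hτ.le R v)) fun u _ => ?_
    have h2 := (abs_le.1 (hg (c + (τ * (1 - R)) • v + (r + τ * R) • u) (c + r • u))).1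
    have h3 : c + (τ * (1 - R)) • v + (r + τ * R) • u - (c + r • u) =
        (τ * (1 - R)) • v + (τ * R) • u := by module
    rw [h3, ← mul_norm_shift hτ.le] at h2
    linarith

/-- Integration in cylindrical coordinates. -/
theorem integral_cylindrical {m : ℕ} (hm : 0 < m) (H : ℝ → ℝ → ℝ)
    (hH_int : Integrable fun u : EuclideanSpace ℝ (Fin (m + 1)) =>
      H (u 0) √(∑ i : Fin m, u i.succ ^ 2)) :
    ∫ u : EuclideanSpace ℝ (Fin (m + 1)), H (u 0) √(∑ i : Fin m, u i.succ ^ 2) =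
      (m * volume.real (ball (0 : EuclideanSpace ℝ (Fin m)) 1)) *
        ∫ x : ℝ, ∫ ρ in Ioi (0 : ℝ), H x ρ * ρ ^ (m - 1) := by
  have : Nonempty (Fin m) := ⟨⟨0, hm⟩⟩
  let e := MeasurableEquiv.piFinSuccAbove (fun _ : Fin (m + 1) => ℝ) 0
  have he : MeasurePreserving e := volume_preserving_piFinSuccAbove (fun _ : Fin (m + 1) => ℝ) 0
  have hto : MeasurePreserving (MeasurableEquiv.toLp 2 (Fin m → ℝ)) :=
    PiLp.volume_preserving_toLp (Fin m)
  have hof : MeasurePreserving (MeasurableEquiv.toLp 2 (Fin (m + 1) → ℝ)).symm :=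
    PiLp.volume_preserving_ofLp (Fin (m + 1))
  let e' : EuclideanSpace ℝ (Fin (m + 1)) ≃ᵐ ℝ × EuclideanSpace ℝ (Fin m) :=
    ((MeasurableEquiv.toLp 2 (Fin (m + 1) → ℝ)).symm.trans e).trans
      ((MeasurableEquiv.refl ℝ).prodCongr (MeasurableEquiv.toLp 2 (Fin m → ℝ)))
  have he' : MeasurePreserving e' :=
    ((MeasurePreserving.id volume).prod hto).comp (he.comp hof)
  have hH : ∀ u : EuclideanSpace ℝ (Fin (m + 1)),
      H (u 0) √(∑ i : Fin m, u i.succ ^ 2) = (fun p => H p.1 ‖p.2‖) (e' u) := by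
    intro u
    have h2 : ‖(e' u).2‖ = √(∑ i : Fin m, u i.succ ^ 2) := by
      rw [EuclideanSpace.norm_eq]
      simp only [Real.norm_eq_abs, sq_abs]
      rfl
    simp only [h2]
    rfl
  simp only [hH] at hH_int ⊢
  have hH_int' : Integrable (fun p : ℝ × EuclideanSpace ℝ (Fin m) => H p.1 ‖p.2‖) :=
    (he'.integrable_comp_emb e'.measurableEmbedding).1 hH_int
  rw [he'.integral_comp e'.measurableEmbedding (fun p => H p.1 ‖p.2‖), Measure.volume_eq_prod,
    integral_prod _ hH_int', ← integral_const_mul]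
  congr 1
  ext x
  rw [integral_fun_norm_addHaar volume (H x), finrank_euclideanSpace_fin, nsmul_eq_mul,
    smul_eq_mul, ← mul_assoc]
  simp only [smul_eq_mul, mul_comm]

theorem volume_ball_ratio {m : ℕ} (hm : 0 < m) :
    (volume.real (closedBall (0 : EuclideanSpace ℝ (Fin (m + 1))) 1))⁻¹ *
      (m * volume.real (ball (0 : EuclideanSpace ℝ (Fin m)) 1)) =
    m * Real.Gamma (1 + ((m + 1 : ℕ) : ℝ) / 2) /
      (√Real.pi * Real.Gamma (1 / 2 + ((m + 1 : ℕ) : ℝ) / 2)) := by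
  have : Nonempty (Fin m) := ⟨⟨0, hm⟩⟩
  have hpi : 0 < √Real.pi := Real.sqrt_pos.2 Real.pi_pos
  have hG : ∀ k : ℕ, 0 < Real.Gamma ((k : ℝ) / 2 + 1) := fun k =>
    Real.Gamma_pos_of_pos (by positivity)
  have h1 := hG m
  have h2 := hG (m + 1)
  simp only [Measure.real, EuclideanSpace.volume_ball, EuclideanSpace.volume_closedBall,
    Fintype.card_fin, ENNReal.ofReal_one, one_pow, one_mul]
  rw [ENNReal.toReal_ofReal (by positivity), ENNReal.toReal_ofReal (by positivity),
    show 1 + ((m + 1 : ℕ) : ℝ) / 2 = ((m + 1 : ℕ) : ℝ) / 2 + 1 by ring,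
    show 1 / 2 + ((m + 1 : ℕ) : ℝ) / 2 = (m : ℝ) / 2 + 1 by push_cast; ring]
  field_simp
  rw [pow_succ]

theorem shiftedAvg_eq_integral {m : ℕ} (hm : 0 < m) {ω : ℝ → ℝ} (hω : ContinuousOn ω (Ici 0))
    {t : ℝ} (ht : 0 ≤ t) (R : ℝ) :
    shiftedAvg ω t R (EuclideanSpace.single 0 1 : EuclideanSpace ℝ (Fin (m + 1))) =
      m * Real.Gamma (1 + ((m + 1 : ℕ) : ℝ) / 2) /
        (√Real.pi * Real.Gamma (1 / 2 + ((m + 1 : ℕ) : ℝ) / 2)) *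
      ∫ u in Icc (-1 : ℝ) 1, ∫ ρ in Icc (0 : ℝ) √(1 - u ^ 2),
        ω (t * √((1 - R + R * u) ^ 2 + R ^ 2 * ρ ^ 2)) * ρ ^ (m - 1) := by
  set F : ℝ → ℝ → ℝ := fun x ρ => ω (t * √((1 - R + R * x) ^ 2 + R ^ 2 * ρ ^ 2)) with hF
  set H : ℝ → ℝ → ℝ := fun x ρ => if x ^ 2 + ρ ^ 2 ≤ 1 then F x ρ else 0 with hH
  have hsq : ∀ u : EuclideanSpace ℝ (Fin (m + 1)),
      √(∑ i : Fin m, u i.succ ^ 2) ^ 2 = ∑ i : Fin m, u i.succ ^ 2 := fun u =>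
    Real.sq_sqrt (Finset.sum_nonneg fun i _ => sq_nonneg _)
  have hind : ∀ u : EuclideanSpace ℝ (Fin (m + 1)),
      (closedBall (0 : EuclideanSpace ℝ (Fin (m + 1))) 1).indicator (fun u =>
        ω (t * ‖(1 - R) • (EuclideanSpace.single 0 1 : EuclideanSpace ℝ (Fin (m + 1))) +
          R • u‖)) u = H (u 0) √(∑ i : Fin m, u i.succ ^ 2) := by
    intro u
    have h1 : u ∈ closedBall (0 : EuclideanSpace ℝ (Fin (m + 1))) 1 ↔
        u 0 ^ 2 + √(∑ i : Fin m, u i.succ ^ 2) ^ 2 ≤ 1 := by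
      rw [mem_closedBall_zero_iff, hsq, EuclideanSpace.norm_eq, Real.sqrt_le_iff,
        Fin.sum_univ_succ]
      simp only [zero_le_one, true_and, one_pow, Real.norm_eq_abs, sq_abs]
    have h2 : ‖(1 - R) • (EuclideanSpace.single 0 1 : EuclideanSpace ℝ (Fin (m + 1))) + R • u‖ =
        √((1 - R + R * u 0) ^ 2 + R ^ 2 * √(∑ i : Fin m, u i.succ ^ 2) ^ 2) := by
      rw [hsq, EuclideanSpace.norm_eq, Fin.sum_univ_succ, Finset.mul_sum]
      simp [mul_pow]
    simp only [indicator, hH, h1, hF, h2]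
  have hH_int : Integrable fun u : EuclideanSpace ℝ (Fin (m + 1)) =>
      H (u 0) √(∑ i : Fin m, u i.succ ^ 2) := by
    simp only [← hind]
    exact (integrable_indicator_iff measurableSet_closedBall).2
      ((continuous_comp_shift hω ht R _).continuousOn.integrableOn_compact
        (isCompact_closedBall _ _))
  have hslice : ∀ x : ℝ, ∫ ρ in Ioi (0 : ℝ), H x ρ * ρ ^ (m - 1) =
      (Icc (-1 : ℝ) 1).indicator (fun x => ∫ ρ in Icc (0 : ℝ) √(1 - x ^ 2),
        F x ρ * ρ ^ (m - 1)) x := by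
    intro x
    have hx : x ∈ Icc (-1 : ℝ) 1 ↔ 0 ≤ 1 - x ^ 2 := by
      rw [mem_Icc, ← abs_le, sub_nonneg, sq_le_one_iff_abs_le_one]
    by_cases h : x ∈ Icc (-1 : ℝ) 1
    · rw [indicator_of_mem h, integral_Icc_eq_integral_Ioc,
        ← integral_indicator measurableSet_Ioi, ← integral_indicator measurableSet_Ioc]
      congr 1
      ext ρ
      by_cases hρ : 0 < ρ
      · have : x ^ 2 + ρ ^ 2 ≤ 1 ↔ ρ ≤ √(1 - x ^ 2) := by
          rw [Real.le_sqrt' hρ]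
          constructor <;> intro <;> linarith
        simp [indicator, hρ, hH, this, ite_mul]
      · simp [indicator, hρ]
    · rw [indicator_of_notMem h]
      have h0 : ∀ ρ : ℝ, H x ρ * ρ ^ (m - 1) = 0 := by
        intro ρ
        have : ¬ x ^ 2 + ρ ^ 2 ≤ 1 := by
          rw [hx] at h
          nlinarith [sq_nonneg ρ]
        simp [hH, this]
      simp [h0]
  rw [shiftedAvg, setAverage_eq, ← integral_indicator measurableSet_closedBall]
  simp only [hind]
  rw [integral_cylindrical hm H hH_int, smul_eq_mul, ← mul_assoc, volume_ball_ratio hm]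
  simp only [hslice]
  rw [integral_indicator measurableSet_Icc]

theorem IsModulus.pos {ω : ℝ → ℝ} (hω : IsModulus ω) {t : ℝ} (ht : 0 < t) : 0 < ω t := by
  refine lt_of_le_of_ne (hω.nonneg t ht.le) fun h0 => ?_
  obtain ⟨s, hs, hs0⟩ := hω.nontrivial
  have hn : ∀ n : ℕ, ω (n * t) = 0 := by
    intro n
    induction n with
    | zero => simpa using hω.map_zero
    | succ n ih =>
      have h1 := hω.subadd (n * t) t (by positivity) ht.le
      have h2 := hω.nonneg ((n + 1 : ℕ) * t) (by positivity)
      rw [ih, ← h0] at h1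
      push_cast at h2 ⊢
      rw [add_one_mul] at h2 ⊢
      linarith
  obtain ⟨n, hsn⟩ := exists_nat_ge (s / t)
  rw [div_le_iff₀ ht] at hsn
  have h1 := hω.mono hs.le (hs.le.trans hsn) hsn
  rw [hn] at h1
  exact hs0 (le_antisymm h1 (hω.nonneg s hs.le))

theorem IsModulus.abs_sub_le {ω : ℝ → ℝ} (hω : IsModulus ω) {a b : ℝ} (ha : 0 ≤ a)
    (hb : 0 ≤ b) : |ω a - ω b| ≤ ω |a - b| := by
  wlog hab : b ≤ a generalizing a b
  · rw [abs_sub_comm, abs_sub_comm a]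
    exact this hb ha (le_of_not_ge hab)
  rw [abs_of_nonneg (sub_nonneg.2 (hω.mono hb ha hab)), abs_of_nonneg (sub_nonneg.2 hab)]
  have := hω.subadd (a - b) b (sub_nonneg.2 hab) hb
  rw [sub_add_cancel] at this
  linarith

/-- The euclidean norm on `Fin d → ℝ`. -/
noncomputable def euclNorm (d : ℕ) (x : Fin d → ℝ) : ℝ :=
  ‖(WithLp.toLp 2 x : EuclideanSpace ℝ (Fin d))‖

theorem euclNorm_eq (d : ℕ) : euclNorm d = fun x => √(∑ i, x i ^ 2) := by
  ext x
  simp [euclNorm, EuclideanSpace.norm_eq]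

theorem euclNorm_sub {d : ℕ} (x y : Fin d → ℝ) : euclNorm d (x - y) =
    ‖(WithLp.toLp 2 x : EuclideanSpace ℝ (Fin d)) - WithLp.toLp 2 y‖ := rfl

theorem setAverage_nball {d : ℕ} (g : (Fin d → ℝ) → ℝ) (c : Fin d → ℝ) {r : ℝ} (hr : 0 < r) :
    ⨍ y in nball (euclNorm d) c r, g y =
      ⨍ u in closedBall (0 : EuclideanSpace ℝ (Fin d)) 1,
        g (WithLp.ofLp (WithLp.toLp 2 c + r • u)) := by
  rw [← setAverage_closedBall_eq (fun z : EuclideanSpace ℝ (Fin d) => g z.ofLp) _ hr]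
  have he : MeasurePreserving (MeasurableEquiv.toLp 2 (Fin d → ℝ)) :=
    PiLp.volume_preserving_toLp (Fin d)
  have hpre : nball (euclNorm d) c r = MeasurableEquiv.toLp 2 (Fin d → ℝ) ⁻¹'
      closedBall (WithLp.toLp 2 c) r := by
    ext y
    rw [mem_preimage, mem_closedBall, dist_eq_norm]
    rfl
  rw [setAverage_eq, setAverage_eq, hpre, ← he.setIntegral_preimage_emb
    (MeasurableEquiv.measurableEmbedding _), Measure.real, he.measure_preimage_equiv]
  rfl

/-- The averages whose supremum is the maximal function, as averages over the unit ball. -/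
def maxSet {d : ℕ} (f : (Fin d → ℝ) → ℝ) (x : Fin d → ℝ) : Set ℝ :=
  {a | ∃ (c : EuclideanSpace ℝ (Fin d)) (r : ℝ), 0 < r ∧ ‖WithLp.toLp 2 x - c‖ ≤ r ∧
    a = ⨍ u in closedBall (0 : EuclideanSpace ℝ (Fin d)) 1, |f (WithLp.ofLp (c + r • u))|}

theorem maxFn_eq_sSup {d : ℕ} (f : (Fin d → ℝ) → ℝ) (x : Fin d → ℝ) :
    maxFn (euclNorm d) f x = sSup (maxSet f x) := by
  rw [maxFn, maxSet]
  congr 1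
  ext a
  constructor
  · rintro ⟨c, r, hr, hx, rfl⟩
    exact ⟨WithLp.toLp 2 c, r, hr, hx, setAverage_nball _ c hr⟩
  · rintro ⟨c, r, hr, hx, rfl⟩
    exact ⟨c.ofLp, r, hr, hx, (setAverage_nball (fun y => |f y|) c.ofLp hr).symm⟩

theorem maxSet_nonempty {d : ℕ} (f : (Fin d → ℝ) → ℝ) (x : Fin d → ℝ) : (maxSet f x).Nonempty :=
  ⟨_, WithLp.toLp 2 x, 1, one_pos, by simp, rfl⟩

theorem modCont_le {d : ℕ} {g : (Fin d → ℝ) → ℝ} {t K : ℝ} (ht : 0 ≤ t)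
    (hg : ∀ x y, euclNorm d (x - y) ≤ t → |g x - g y| ≤ K) : modCont (euclNorm d) g t ≤ K := by
  refine csSup_le ⟨_, 0, 0, by simpa [euclNorm] using ht, rfl⟩ ?_
  rintro a ⟨x, y, hxy, rfl⟩
  exact hg x y hxy

theorem le_modCont {d : ℕ} {g : (Fin d → ℝ) → ℝ} {t K : ℝ}
    (hg : ∀ x y, euclNorm d (x - y) ≤ t → |g x - g y| ≤ K) {x y : Fin d → ℝ}
    (hxy : euclNorm d (x - y) ≤ t) : |g x - g y| ≤ modCont (euclNorm d) g t := by
  refine le_csSup ⟨K, ?_⟩ ⟨x, y, hxy, rfl⟩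
  rintro a ⟨x, y, hxy, rfl⟩
  exact hg x y hxy

/-- Oscillation bounds at one scale give oscillation bounds at all scales. -/
theorem abs_sub_le_two_pow_mul {d : ℕ} {g : (Fin d → ℝ) → ℝ} {t K : ℝ}
    (hg : ∀ x y, euclNorm d (x - y) ≤ t → |g x - g y| ≤ K) (n : ℕ) :
    ∀ x y, euclNorm d (x - y) ≤ 2 ^ n * t → |g x - g y| ≤ 2 ^ n * K := by
  induction n with
  | zero => simpa using hg
  | succ n ih =>
    intro x y hxy
    have hhalf : ∀ z : Fin d → ℝ, euclNorm d ((1 / 2 : ℝ) • z) = 1 / 2 * euclNorm d z := by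
      intro z
      rw [euclNorm, WithLp.toLp_smul, norm_smul, Real.norm_of_nonneg (by norm_num)]
      rfl
    have hz : x - (1 / 2 : ℝ) • (x + y) = (1 / 2 : ℝ) • (x - y) ∧
        (1 / 2 : ℝ) • (x + y) - y = (1 / 2 : ℝ) • (x - y) := ⟨by module, by module⟩
    rw [pow_succ] at hxy
    have h1 := ih x ((1 / 2 : ℝ) • (x + y)) (by rw [hz.1, hhalf]; linarith)
    have h2 := ih ((1 / 2 : ℝ) • (x + y)) y (by rw [hz.2, hhalf]; linarith)
    have h3 := abs_sub_le (g x) (g ((1 / 2 : ℝ) • (x + y))) (g y)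
    rw [pow_succ]
    linarith

theorem abs_sub_le_of_lipNorm_eq_one {d : ℕ} {ω : ℝ → ℝ} (hω : IsModulus ω)
    {f : (Fin d → ℝ) → ℝ} (hf : lipNorm (euclNorm d) ω f = 1) (x y : Fin d → ℝ) :
    |f x - f y| ≤ ω (euclNorm d (x - y)) := by
  rcases (norm_nonneg _ : 0 ≤ euclNorm d (x - y)).eq_or_lt' with h0 | hpos
  · change ‖WithLp.toLp 2 x - WithLp.toLp 2 y‖ = 0 at h0
    rw [norm_eq_zero, sub_eq_zero] at h0
    have : x = y := WithLp.toLp_injective 2 h0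
    rw [this, sub_self, abs_zero]
    exact hω.nonneg _ (norm_nonneg _)
  have hbdd : BddAbove {a : ℝ | ∃ t : ℝ, 0 < t ∧ a = modCont (euclNorm d) f t / ω t} := by
    by_contra h
    rw [lipNorm, Real.sSup_of_not_bddAbove h] at hf
    exact zero_ne_one hf
  have hmod : ∀ t, 0 < t → modCont (euclNorm d) f t ≤ ω t := by
    intro t ht
    have h : modCont (euclNorm d) f t / ω t ≤ lipNorm (euclNorm d) ω f :=
      le_csSup hbdd ⟨t, ht, rfl⟩
    rwa [hf, div_le_one (hω.pos ht)] at h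
  by_cases hK : ∃ t K, 0 < t ∧ ∀ x y, euclNorm d (x - y) ≤ t → |f x - f y| ≤ K
  · obtain ⟨t, K, ht, hK⟩ := hK
    obtain ⟨n, hn⟩ := pow_unbounded_of_one_lt (euclNorm d (x - y) / t) one_lt_two
    rw [div_lt_iff₀ ht] at hn
    have := abs_sub_le_two_pow_mul hK n
    exact (le_modCont (fun x' y' h => this x' y' (h.trans hn.le)) le_rfl).trans (hmod _ hpos)
  · have hz : ∀ t, 0 < t → modCont (euclNorm d) f t = 0 := by
      intro t ht
      refine Real.sSup_of_not_bddAbove fun ⟨K, h⟩ => hK ⟨t, K, ht, fun x y hxy => ?_⟩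
      exact h ⟨x, y, hxy, rfl⟩
    have : lipNorm (euclNorm d) ω f ≤ 0 := by
      refine Real.sSup_nonpos ?_
      rintro a ⟨t, ht, rfl⟩
      rw [hz t ht, zero_div]
    rw [hf] at this
    exact absurd this (by norm_num)

section Bounds

variable {d : ℕ} {ω : ℝ → ℝ} {f : (Fin d → ℝ) → ℝ} {e : EuclideanSpace ℝ (Fin d)}

theorem exists_mem_maxSet_le (hω : IsModulus ω)
    (hf : ∀ x y, |f x - f y| ≤ ω (euclNorm d (x - y))) (he : ‖e‖ = 1) {t R : ℝ} (ht : 0 < t)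
    (hR : 0 < R) {x y : Fin d → ℝ} (hxy : euclNorm d (x - y) ≤ t) {a : ℝ} (ha : a ∈ maxSet f x) :
    ∃ b ∈ maxSet f y, a ≤ b + shiftedAvg ω t R e := by
  obtain ⟨c, r, hr, hx, rfl⟩ := ha
  have hg : ∀ x y : EuclideanSpace ℝ (Fin d),
      |(|f x.ofLp|) - (|f y.ofLp|)| ≤ ω ‖x - y‖ := fun x y =>
    (abs_abs_sub_abs_le _ _).trans (hf x.ofLp y.ofLp)
  have hgc : Continuous fun z : EuclideanSpace ℝ (Fin d) => |f z.ofLp| := by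
    rw [continuous_iff_continuousAt]
    intro z
    rw [ContinuousAt, tendsto_iff_dist_tendsto_zero]
    have h0 : Tendsto (fun w : EuclideanSpace ℝ (Fin d) => ω ‖w - z‖) (𝓝 z) (𝓝 0) := by
      have : Continuous fun w : EuclideanSpace ℝ (Fin d) => ω ‖w - z‖ :=
        hω.cont.comp_continuous (by fun_prop) fun w => norm_nonneg _
      have h := this.tendsto z
      rwa [sub_self, norm_zero, hω.map_zero] at h
    exact squeeze_zero (fun w => dist_nonneg) (fun w => hg w z) h0
  obtain ⟨c', r', hr', hy, hle⟩ := exists_ball_setAverage_le hω hg hgc hr hx ht hxy hR he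
  exact ⟨_, ⟨c', r', hr', hy, rfl⟩, hle⟩

theorem maxFn_le_add (hω : IsModulus ω) (hf : ∀ x y, |f x - f y| ≤ ω (euclNorm d (x - y)))
    (he : ‖e‖ = 1) {t R : ℝ} (ht : 0 < t) (hR : 0 < R) {x y : Fin d → ℝ}
    (hxy : euclNorm d (x - y) ≤ t) :
    maxFn (euclNorm d) f x ≤ maxFn (euclNorm d) f y + shiftedAvg ω t R e := by
  rw [maxFn_eq_sSup, maxFn_eq_sSup]
  by_cases hb : BddAbove (maxSet f y)
  · refine csSup_le (maxSet_nonempty f x) fun a ha => ?_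
    obtain ⟨b, hb', hab⟩ := exists_mem_maxSet_le hω hf he ht hR hxy ha
    exact hab.trans (by gcongr; exact le_csSup hb hb')
  · have hb' : ¬ BddAbove (maxSet f x) := by
      rintro ⟨K, hK⟩
      refine hb ⟨K + shiftedAvg ω t R e, fun a ha => ?_⟩
      rw [euclNorm_sub, norm_sub_rev, ← euclNorm_sub] at hxy
      obtain ⟨b, hb', hab⟩ := exists_mem_maxSet_le hω hf he ht hR hxy ha
      exact hab.trans (by gcongr; exact hK hb')
    rw [Real.sSup_of_not_bddAbove hb, Real.sSup_of_not_bddAbove hb', zero_add]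
    exact shiftedAvg_nonneg hω ht.le R e

theorem abs_maxFn_sub_le (hω : IsModulus ω) (hf : ∀ x y, |f x - f y| ≤ ω (euclNorm d (x - y)))
    (he : ‖e‖ = 1) {t R : ℝ} (ht : 0 < t) (hR : 0 < R) {x y : Fin d → ℝ}
    (hxy : euclNorm d (x - y) ≤ t) :
    |maxFn (euclNorm d) f x - maxFn (euclNorm d) f y| ≤ shiftedAvg ω t R e := by
  have h1 := maxFn_le_add hω hf he ht hR hxy
  rw [euclNorm_sub, norm_sub_rev, ← euclNorm_sub] at hxy
  have h2 := maxFn_le_add hω hf he ht hR hxy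
  rw [abs_le]
  constructor <;> linarith

end Bounds

/-- The smallest normalized average of `ω` at scale `t`. -/
noncomputable def infAvg {d : ℕ} (ω : ℝ → ℝ) (e : EuclideanSpace ℝ (Fin d)) (t : ℝ) : ℝ :=
  sInf {b : ℝ | ∃ R : ℝ, 1 / 2 ≤ R ∧ R ≤ 1 ∧ b = shiftedAvg ω t R e / ω t}

section InfAvg

variable {d : ℕ} {ω : ℝ → ℝ} {e : EuclideanSpace ℝ (Fin d)}

theorem infAvg_le (hω : IsModulus ω) {t R : ℝ} (ht : 0 < t) (h0 : 1 / 2 ≤ R) (h1 : R ≤ 1) :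
    infAvg ω e t ≤ shiftedAvg ω t R e / ω t := by
  refine csInf_le ⟨0, ?_⟩ ⟨R, h0, h1, rfl⟩
  rintro b ⟨R, -, -, rfl⟩
  exact div_nonneg (shiftedAvg_nonneg hω ht.le R e) (hω.pos ht).le

theorem infAvg_le_one (hω : IsModulus ω) (he : ‖e‖ = 1) {t : ℝ} (ht : 0 < t) :
    infAvg ω e t ≤ 1 :=
  (infAvg_le hω ht (by norm_num) le_rfl).trans
    ((div_le_one (hω.pos ht)).2 (shiftedAvg_le hω ht.le zero_le_one le_rfl he))

theorem modCont_maxFn_div_le (hω : IsModulus ω) (he : ‖e‖ = 1) {f : (Fin d → ℝ) → ℝ}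
    (hf : lipNorm (euclNorm d) ω f = 1) {t : ℝ} (ht : 0 < t) :
    modCont (euclNorm d) (maxFn (euclNorm d) f) t / ω t ≤ infAvg ω e t := by
  refine le_csInf ⟨_, 1, by norm_num, le_rfl, rfl⟩ ?_
  rintro b ⟨R, hR, -, rfl⟩
  refine div_le_div_of_nonneg_right (modCont_le ht.le fun x y hxy => ?_) (hω.pos ht).le
  exact abs_maxFn_sub_le hω (abs_sub_le_of_lipNorm_eq_one hω hf) he ht (by linarith) hxy

/-- The truncated radial function for which the bound is attained at scale `t`. -/
noncomputable def truncatedPeak (d : ℕ) (ω : ℝ → ℝ) (t : ℝ) (x : Fin d → ℝ) : ℝ :=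
  ω t - ω (min (euclNorm d x) t)

theorem lipNorm_truncatedPeak (hω : IsModulus ω) (he : ‖e‖ = 1) {t : ℝ} (ht : 0 < t) :
    lipNorm (euclNorm d) ω (truncatedPeak d ω t) = 1 := by
  have hlip : ∀ x y, |truncatedPeak d ω t x - truncatedPeak d ω t y| ≤
      ω (euclNorm d (x - y)) := by
    intro x y
    have h1 : (0 : ℝ) ≤ min (euclNorm d x) t := le_min (norm_nonneg _) ht.le
    have h2 : (0 : ℝ) ≤ min (euclNorm d y) t := le_min (norm_nonneg _) ht.le
    rw [truncatedPeak, truncatedPeak, sub_sub_sub_cancel_left, abs_sub_comm]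
    refine (hω.abs_sub_le h1 h2).trans (hω.mono (mem_Ici.2 (abs_nonneg _)) (norm_nonneg _) ?_)
    exact (abs_inf_sub_inf_le_abs _ _ _).trans (abs_norm_sub_norm_le _ _)
  have hlip' : ∀ s, ∀ x y, euclNorm d (x - y) ≤ s →
      |truncatedPeak d ω t x - truncatedPeak d ω t y| ≤ ω s := fun s x y h =>
    (hlip x y).trans (hω.mono (norm_nonneg _) ((norm_nonneg _).trans h) h)
  have hle : ∀ a ∈ {a : ℝ | ∃ s : ℝ, 0 < s ∧
      a = modCont (euclNorm d) (truncatedPeak d ω t) s / ω s}, a ≤ 1 := by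
    rintro a ⟨s, hs, rfl⟩
    exact (div_le_one (hω.pos hs)).2 (modCont_le hs.le (hlip' s))
  refine le_antisymm (csSup_le ⟨_, t, ht, rfl⟩ hle) (le_csSup_of_le ⟨1, hle⟩ ⟨t, ht, rfl⟩ ?_)
  rw [one_le_div (hω.pos ht)]
  have hnorm : euclNorm d (t • e).ofLp = t := by
    change ‖t • e‖ = t
    rw [norm_smul, he, mul_one, Real.norm_of_nonneg ht.le]
  have h0 : euclNorm d 0 = 0 := by simp [euclNorm]
  refine le_trans ?_ (le_modCont (hlip' t) (x := (t • e).ofLp) (y := 0) (by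
    rw [sub_zero, hnorm]))
  rw [truncatedPeak, truncatedPeak, hnorm, h0, min_self, min_eq_left ht.le, hω.map_zero]
  rw [sub_self, sub_zero, zero_sub, abs_neg]
  exact le_abs_self _

theorem infAvg_le_lipNorm_maxFn (hω : IsModulus ω) (he : ‖e‖ = 1) {t : ℝ} (ht : 0 < t) :
    infAvg ω e t ≤ lipNorm (euclNorm d) ω (maxFn (euclNorm d) (truncatedPeak d ω t)) := by
  have hlip := lipNorm_truncatedPeak (d := d) hω he ht
  have hωt := hω.pos ht
  refine le_csSup_of_le ⟨1, ?_⟩ ⟨t, ht, rfl⟩ ?_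
  · rintro a ⟨s, hs, rfl⟩
    exact (modCont_maxFn_div_le hω he hlip hs).trans (infAvg_le_one hω he hs)
  rw [le_div_iff₀ hωt]
  set ψ : ℝ → ℝ := fun s => ω (min s t) with hψ_def
  have hψ : MonotoneOn ψ (Ici 0) := fun a ha b hb hab =>
    hω.mono (le_min ha ht.le) (le_min hb ht.le) (min_le_min_right t hab)
  have hψc : ContinuousOn ψ (Ici 0) :=
    hω.cont.comp (by fun_prop) fun s hs => le_min hs ht.le
  have hψt : ∀ s, 0 ≤ s → ψ s ≤ ω t := fun s hs =>
    hω.mono (le_min hs ht.le) ht.le (min_le_right s t)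
  have hcont : ∀ (c : EuclideanSpace ℝ (Fin d)) (r : ℝ),
      Continuous fun u : EuclideanSpace ℝ (Fin d) => ψ ‖c + r • u‖ := fun c r =>
    hψc.comp_continuous (by fun_prop) fun u => norm_nonneg _
  have habs : ∀ z : EuclideanSpace ℝ (Fin d), |truncatedPeak d ω t z.ofLp| = ω t - ψ ‖z‖ :=
    fun z => abs_of_nonneg (sub_nonneg.2 (hψt ‖z‖ (norm_nonneg _)))
  have havg : ∀ (c : EuclideanSpace ℝ (Fin d)) (r : ℝ),
      ⨍ u in closedBall (0 : EuclideanSpace ℝ (Fin d)) 1,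
        |truncatedPeak d ω t (WithLp.ofLp (c + r • u))| =
      ω t - ⨍ u in closedBall (0 : EuclideanSpace ℝ (Fin d)) 1, ψ ‖c + r • u‖ := by
    intro c r
    have h := setAverage_unitBall_add (g := fun u => ω t - ψ ‖c + r • u‖)
      (continuous_const.sub (hcont c r)) (hcont c r)
    simp only [sub_add_cancel, setAverage_unitBall_const] at h
    simp only [habs]
    linarith
  have hbdd : ∀ x, BddAbove (maxSet (truncatedPeak d ω t) x) := by
    intro x
    refine ⟨ω t, ?_⟩
    rintro a ⟨c, r, -, -, rfl⟩
    rw [havg, sub_le_self_iff, ← setAverage_unitBall_const (E := EuclideanSpace ℝ (Fin d)) 0]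
    exact setAverage_unitBall_mono continuous_const (hcont c r) fun u _ =>
      hω.nonneg _ (le_min (norm_nonneg _) ht.le)
  have h0 : ω t ≤ maxFn (euclNorm d) (truncatedPeak d ω t) 0 := by
    have hr : ∀ r ∈ Ioi (0 : ℝ),
        ω t - ω r ≤ maxFn (euclNorm d) (truncatedPeak d ω t) 0 := by
      intro r hr
      have hr0 : 0 ≤ r := le_of_lt hr
      rw [maxFn_eq_sSup]
      refine le_csSup_of_le (hbdd 0) ⟨0, r, hr, by simpa using hr0, rfl⟩ ?_
      rw [havg]
      refine sub_le_sub_left ?_ _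
      rw [← setAverage_unitBall_const (E := EuclideanSpace ℝ (Fin d)) (ω r)]
      refine setAverage_unitBall_mono (hcont 0 r) continuous_const fun u hu => ?_
      refine hω.mono (le_min (norm_nonneg _) ht.le) hr0 ((min_le_left _ _).trans ?_)
      rw [zero_add, norm_smul, Real.norm_of_nonneg hr0]
      exact mul_le_of_le_one_right hr0 hu
    have hlim : Tendsto (fun r => ω t - ω r) (𝓝[>] 0) (𝓝 (ω t - 0)) := by
      have h := (hω.cont 0 self_mem_Ici).tendsto.mono_left (nhdsWithin_mono 0 Ioi_subset_Ici_self)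
      rw [hω.map_zero] at h
      exact tendsto_const_nhds.sub h
    rw [sub_zero] at hlim
    exact le_of_tendsto hlim (eventually_of_mem self_mem_nhdsWithin hr)
  have h1 : maxFn (euclNorm d) (truncatedPeak d ω t) (t • e).ofLp ≤
      ω t - infAvg ω e t * ω t := by
    rw [maxFn_eq_sSup]
    refine csSup_le (maxSet_nonempty _ _) ?_
    rintro a ⟨c, r, hr, hc, rfl⟩
    rw [havg]
    refine sub_le_sub_left ?_ _
    obtain ⟨R, hR0, hR1, hR⟩ := exists_shifted_setAverage_le hψ hψc ht hr he hc
    refine le_trans ?_ hR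
    refine ((le_div_iff₀ hωt).1 (infAvg_le hω ht hR0 hR1)).trans ?_
    refine setAverage_unitBall_mono (continuous_comp_shift hω.cont ht.le R e)
      (continuous_comp_shift hψc ht.le R e) fun u hu => ?_
    rw [hψ_def]
    dsimp only
    rw [min_eq_left (mul_le_of_le_one_right ht.le
      (norm_shift_le_one (by linarith) hR1 he hu))]
  have hdist : euclNorm d (0 - (t • e).ofLp) ≤ t := by
    rw [euclNorm_sub, WithLp.toLp_zero, zero_sub, norm_neg]
    change ‖t • e‖ ≤ t
    rw [norm_smul, he, mul_one, Real.norm_of_nonneg ht.le]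
  have h2 := le_modCont (g := maxFn (euclNorm d) (truncatedPeak d ω t)) (fun x y hxy =>
    abs_maxFn_sub_le hω (abs_sub_le_of_lipNorm_eq_one hω hlip) he ht one_pos hxy) hdist
  linarith [le_abs_self (maxFn (euclNorm d) (truncatedPeak d ω t) 0 -
    maxFn (euclNorm d) (truncatedPeak d ω t) (t • e).ofLp)]

theorem opNorm_eq_sSup_infAvg (hω : IsModulus ω) (he : ‖e‖ = 1) :
    opNorm d (euclNorm d) ω = sSup {a : ℝ | ∃ t : ℝ, 0 < t ∧ a = infAvg ω e t} := by
  have hbdd : BddAbove {a : ℝ | ∃ t : ℝ, 0 < t ∧ a = infAvg ω e t} := by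
    refine ⟨1, ?_⟩
    rintro a ⟨t, ht, rfl⟩
    exact infAvg_le_one hω he ht
  have hle : ∀ f, lipNorm (euclNorm d) ω f = 1 → lipNorm (euclNorm d) ω (maxFn (euclNorm d) f) ≤
      sSup {a : ℝ | ∃ t : ℝ, 0 < t ∧ a = infAvg ω e t} := by
    intro f hf
    refine csSup_le ⟨_, 1, one_pos, rfl⟩ ?_
    rintro a ⟨t, ht, rfl⟩
    exact le_csSup_of_le hbdd ⟨t, ht, rfl⟩ (modCont_maxFn_div_le hω he hf ht)
  refine le_antisymm (csSup_le ⟨_, _, lipNorm_truncatedPeak hω he one_pos, rfl⟩ ?_)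
    (csSup_le ⟨_, 1, one_pos, rfl⟩ ?_)
  · rintro a ⟨f, hf, rfl⟩
    exact hle f hf
  · rintro a ⟨t, ht, rfl⟩
    refine le_csSup_of_le ⟨sSup {a : ℝ | ∃ t : ℝ, 0 < t ∧ a = infAvg ω e t}, ?_⟩
      ⟨_, lipNorm_truncatedPeak hω he ht, rfl⟩
      (infAvg_le_lipNorm_maxFn hω he ht)
    rintro a ⟨f, hf, rfl⟩
    exact hle f hf

end InfAvg

end MaximalFunction

/-- Integral formula for the operator norm of the uncentered maximal operator associated to
euclidean (`ℓ₂`) balls on `Lip(ω)` (distances in the `ℓ₂` norm). -/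
theorem stmt15 (d : ℕ) (hd : 2 ≤ d) (ω : ℝ → ℝ) (hω : IsModulus ω) :
    opNorm d (fun x => Real.sqrt (∑ i, x i ^ 2)) ω =
      sSup {a : ℝ | ∃ t : ℝ, 0 < t ∧
        a = sInf {b : ℝ | ∃ R : ℝ, 1 / 2 ≤ R ∧ R ≤ 1 ∧
          b = (((d : ℝ) - 1) * Real.Gamma (1 + (d : ℝ) / 2) /
                (ω t * Real.sqrt Real.pi * Real.Gamma (1 / 2 + (d : ℝ) / 2))) *
              ∫ u in Set.Icc (-1 : ℝ) 1,
                ∫ ρ in Set.Icc (0 : ℝ) (Real.sqrt (1 - u ^ 2)),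
                  ω (t * Real.sqrt ((1 - R + R * u) ^ 2 + R ^ 2 * ρ ^ 2)) *
                    ρ ^ (d - 2)}} := by
  obtain ⟨m, rfl⟩ : ∃ m, d = m + 1 := ⟨d - 1, by omega⟩
  have hm : 0 < m := by omega
  rw [← euclNorm_eq, opNorm_eq_sSup_infAvg hω
    (e := (EuclideanSpace.single 0 1 : EuclideanSpace ℝ (Fin (m + 1)))) (by simp)]
  congr 1
  ext a
  refine exists_congr fun t => and_congr_right fun ht => ?_
  have hset : ∀ R : ℝ,
      shiftedAvg ω t R (EuclideanSpace.single 0 1 : EuclideanSpace ℝ (Fin (m + 1))) / ω t =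
      ((((m + 1 : ℕ) : ℝ) - 1) * Real.Gamma (1 + ((m + 1 : ℕ) : ℝ) / 2) /
        (ω t * √Real.pi * Real.Gamma (1 / 2 + ((m + 1 : ℕ) : ℝ) / 2))) *
      ∫ u in Icc (-1 : ℝ) 1, ∫ ρ in Icc (0 : ℝ) √(1 - u ^ 2),
        ω (t * √((1 - R + R * u) ^ 2 + R ^ 2 * ρ ^ 2)) * ρ ^ (m + 1 - 2) := by
    intro R
    rw [shiftedAvg_eq_integral hm hω.cont ht.le, show m + 1 - 2 = m - 1 by omega,
      mul_div_right_comm, div_div, Nat.cast_add_one, add_sub_cancel_right]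
    congr 2
    ring
  simp only [infAvg, hset]
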